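/- Let A ∈ SL₂(ℤ) be a hyperbolic matrix (|tr A| > 2), acting on the torus 𝕋² = ℝ²/ℤ² with Lebesgue probability measure μ. For any C^∞ functions f, g : 𝕋² → ℂ and any ε > 0, one has ∫ f · (g ∘ Aⁿ) dμ - (∫ f dμ)(∫ g dμ) = o(εⁿ) as n → ∞. Hence the only Ruelle resonance of a linear Anosov map of the torus on C^∞(𝕋²) is 1. -/

import Mathlib

open MeasureTheory

namespace AnosovMix

/-- The unit square. -/
abbrev sq : Set (ℝ × ℝ) := Set.Ioc (0:ℝ) 1 ×ˢ Set.Ioc (0:ℝ) 1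

/-- The character `e(m·v)`. -/
noncomputable def chr (m : Fin 2 → ℤ) (v : ℝ × ℝ) : ℂ :=
  Complex.exp (2 * Real.pi * Complex.I * (m 0 * v.1 + m 1 * v.2))

/-- Fourier coefficient. -/
noncomputable def FC (f : ℝ × ℝ → ℂ) (m : Fin 2 → ℤ) : ℂ := ∫ v in sq, chr (-m) v * f v

/-- Periodicity. -/
def Per (f : ℝ × ℝ → ℂ) : Prop :=
  ∀ (m : ℤ × ℤ) (v : ℝ × ℝ), f (v.1 + m.1, v.2 + m.2) = f v

lemma chr_norm (m : Fin 2 → ℤ) (v : ℝ × ℝ) : ‖chr m v‖ = 1 := by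
  have : (2 * Real.pi * Complex.I * (m 0 * v.1 + m 1 * v.2) : ℂ)
      = ((2 * Real.pi * (m 0 * v.1 + m 1 * v.2) : ℝ) : ℂ) * Complex.I := by
    push_cast; ring
  rw [chr, this, Complex.norm_exp_ofReal_mul_I]

lemma chr_contDiff (m : Fin 2 → ℤ) : ContDiff ℝ (⊤ : ℕ∞) (chr m) := by
  unfold chr
  have h1 : ContDiff ℝ (⊤ : ℕ∞) (fun v : ℝ × ℝ => (v.1 : ℂ)) :=
    Complex.ofRealCLM.contDiff.comp contDiff_fst
  have h2 : ContDiff ℝ (⊤ : ℕ∞) (fun v : ℝ × ℝ => (v.2 : ℂ)) :=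
    Complex.ofRealCLM.contDiff.comp contDiff_snd
  exact (contDiff_const.mul ((contDiff_const.mul h1).add (contDiff_const.mul h2))).cexp

lemma chr_per (m : Fin 2 → ℤ) : Per (chr m) := by
  intro k v
  unfold chr
  rw [Complex.exp_eq_exp_iff_exists_int]
  refine ⟨m 0 * k.1 + m 1 * k.2, ?_⟩
  push_cast; ring

lemma chr_zero (v : ℝ × ℝ) : chr 0 v = 1 := by simp [chr]

lemma intOn {f : ℝ × ℝ → ℂ} (hf : Continuous f) : IntegrableOn f sq := by
  have : IntegrableOn f (Set.Icc (0:ℝ) 1 ×ˢ Set.Icc (0:ℝ) 1) :=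
    hf.continuousOn.integrableOn_compact (isCompact_Icc.prod isCompact_Icc)
  exact this.mono_set (Set.prod_mono Set.Ioc_subset_Icc_self Set.Ioc_subset_Icc_self)

lemma hasFDerivAt_chr (m : Fin 2 → ℤ) (v w : ℝ × ℝ) :
    fderiv ℝ (chr m) v w = 2 * Real.pi * Complex.I * (m 0 * w.1 + m 1 * w.2) * chr m v := by
  have hd : DifferentiableAt ℝ (chr m) v :=
    (chr_contDiff m).differentiable (by simp) v
  have h1 : HasDerivAt (fun t : ℝ => chr m (v + t • w)) (fderiv ℝ (chr m) v w) 0 := by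
    have := hd.hasFDerivAt.hasLineDerivAt w
    exact this
  have h2 : HasDerivAt (fun t : ℝ => chr m (v + t • w))
      (2 * Real.pi * Complex.I * (m 0 * w.1 + m 1 * w.2) * chr m v) 0 := by
    have e : (fun t : ℝ => chr m (v + t • w)) = fun t : ℝ =>
        Complex.exp (2 * Real.pi * Complex.I * (m 0 * w.1 + m 1 * w.2) * (t : ℂ)
          + 2 * Real.pi * Complex.I * (m 0 * v.1 + m 1 * v.2)) := by
      funext t
      simp only [chr, Prod.fst_add, Prod.snd_add, Prod.smul_fst, Prod.smul_snd, smul_eq_mul]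
      congr 1; push_cast; ring
    rw [e]
    have h3 := (((Complex.ofRealCLM.hasDerivAt (x := (0:ℝ))).const_mul
      (2 * Real.pi * Complex.I * (m 0 * w.1 + m 1 * w.2) : ℂ)).add_const
        (2 * Real.pi * Complex.I * (m 0 * v.1 + m 1 * v.2) : ℂ)).cexp
    refine HasDerivAt.congr_deriv h3 ?_
    simp only [Complex.ofRealCLM_apply, Complex.ofReal_zero, Complex.ofReal_one, mul_zero, zero_add, mul_one, chr]
    ring
  exact h1.unique h2

/-- unit vectors -/
def ev (i : Fin 2) : ℝ × ℝ := if i = 0 then (1, 0) else (0, 1)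

lemma int_deriv_zero {G : ℝ × ℝ → ℂ} (hG : ContDiff ℝ (⊤ : ℕ∞) G) (hp : Per G) (i : Fin 2) :
    ∫ v in sq, fderiv ℝ G v (ev i) = 0 := by
  have hc : Continuous (fun v => fderiv ℝ G v (ev i)) :=
    (hG.continuous_fderiv (by simp)).clm_apply continuous_const
  have hd : Differentiable ℝ G := hG.differentiable (by simp)
  have hintg := intOn hc
  fin_cases i
  · rw [Measure.volume_eq_prod] at hintg ⊢
    have hsw := setIntegral_prod_swap (μ := (volume : Measure ℝ)) (ν := (volume : Measure ℝ))
      (Set.Ioc (0:ℝ) 1) (Set.Ioc (0:ℝ) 1) (fun v => fderiv ℝ G v (ev 0))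
    have hintg2 : IntegrableOn (fun z : ℝ × ℝ => fderiv ℝ G z.swap (ev 0)) sq
        (volume.prod volume) := by
      rw [← Measure.volume_eq_prod]
      exact intOn (hc.comp continuous_swap)
    show ∫ v in sq, fderiv ℝ G v (ev 0) ∂(volume.prod volume) = 0
    rw [← hsw, setIntegral_prod _ hintg2]
    apply integral_eq_zero_of_ae
    refine Filter.Eventually.of_forall fun y => ?_
    show ∫ x in Set.Ioc (0:ℝ) 1, fderiv ℝ G (x, y) (ev 0) = 0
    rw [← intervalIntegral.integral_of_le zero_le_one]
    rw [intervalIntegral.integral_eq_sub_of_hasDerivAt (f := fun x => G (x, y))]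
    · have := hp (1, 0) (0, y)
      simp at this; simp [this]
    · intro x _
      have := (hd (x, y)).hasFDerivAt.comp_hasDerivAt x
        ((hasDerivAt_id x).prodMk (hasDerivAt_const x y))
      simpa [ev] using! this
    · exact (hc.comp (by fun_prop : Continuous fun x : ℝ => (x, y))).intervalIntegrable _ _
  · rw [Measure.volume_eq_prod] at hintg ⊢
    show ∫ v in sq, fderiv ℝ G v (ev 1) ∂(volume.prod volume) = 0
    have hintg' : IntegrableOn (fun v => fderiv ℝ G v (ev 1)) sq (volume.prod volume) := hintg
    rw [setIntegral_prod _ hintg']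
    apply integral_eq_zero_of_ae
    refine Filter.Eventually.of_forall fun x => ?_
    show ∫ y in Set.Ioc (0:ℝ) 1, fderiv ℝ G (x, y) (ev 1) = 0
    rw [← intervalIntegral.integral_of_le zero_le_one]
    rw [intervalIntegral.integral_eq_sub_of_hasDerivAt (f := fun y => G (x, y))]
    · have := hp (0, 1) (x, 0)
      simp at this; simp [this]
    · intro y _
      have := (hd (x, y)).hasFDerivAt.comp_hasDerivAt y
        ((hasDerivAt_const y x).prodMk (hasDerivAt_id y))
      simpa [ev] using! this
    · exact (hc.comp (by fun_prop : Continuous fun y : ℝ => (x, y))).intervalIntegrable _ _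

lemma per_deriv {f : ℝ × ℝ → ℂ} (hp : Per f) (w : ℝ × ℝ) :
    Per (fun v => fderiv ℝ f v w) := by
  intro m v
  have : (fun v => f (v + ((m.1 : ℝ), (m.2 : ℝ)))) = f := by
    funext v; exact hp m v
  have h2 := fderiv_comp_add_right (𝕜 := ℝ) (f := f) (x := v) ((m.1 : ℝ), (m.2 : ℝ))
  rw [this] at h2
  show fderiv ℝ f (v + ((m.1 : ℝ), (m.2 : ℝ))) w = fderiv ℝ f v w
  rw [h2]

lemma FC_deriv {f : ℝ × ℝ → ℂ} (hf : ContDiff ℝ (⊤ : ℕ∞) f) (hp : Per f) (i : Fin 2)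
    (m : Fin 2 → ℤ) :
    FC (fun v => fderiv ℝ f v (ev i)) m = 2 * Real.pi * Complex.I * m i * FC f m := by
  have h0 := int_deriv_zero ((chr_contDiff (-m)).mul hf)
    (fun k v => by
      show chr (-m) _ * f _ = chr (-m) v * f v
      rw [chr_per (-m) k v, hp k v]) i
  have hd : Differentiable ℝ f := hf.differentiable (by simp)
  have hc : Continuous (fun v => fderiv ℝ f v (ev i)) :=
    (hf.continuous_fderiv (by simp)).clm_apply continuous_const
  have e : ∀ v, fderiv ℝ (fun v => chr (-m) v * f v) v (ev i) =
      chr (-m) v * fderiv ℝ f v (ev i) - 2 * Real.pi * Complex.I * m i * (chr (-m) v * f v) := by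
    intro v
    rw [fderiv_fun_mul ((chr_contDiff (-m)).differentiable (by simp) v) (hd v)]
    simp only [add_apply, smul_apply, hasFDerivAt_chr,
      smul_eq_mul]
    fin_cases i <;> simp [ev] <;> ring
  have h1 : ∫ v in sq, fderiv ℝ (fun v => chr (-m) v * f v) v (ev i) = 0 := h0
  simp_rw [e] at h1
  have i1 : IntegrableOn (fun v => chr (-m) v * fderiv ℝ f v (ev i)) sq :=
    intOn ((chr_contDiff _).continuous.mul hc)
  have i2 : IntegrableOn (fun v => chr (-m) v * f v) sq :=
    intOn ((chr_contDiff _).continuous.mul hf.continuous)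
  rw [integral_sub i1 (i2.const_mul _), integral_const_mul] at h1
  exact sub_eq_zero.mp h1

lemma decay1 (i : Fin 2) (N : ℕ) : ∀ f : ℝ × ℝ → ℂ, ContDiff ℝ (⊤ : ℕ∞) f → Per f →
    ∃ C : ℝ, ∀ m : Fin 2 → ℤ, |(m i : ℝ)| ^ N * ‖FC f m‖ ≤ C := by
  induction N with
  | zero =>
    intro f hf hp
    refine ⟨∫ v in sq, ‖f v‖, fun m => ?_⟩
    rw [pow_zero, one_mul]
    refine (norm_integral_le_integral_norm _).trans (le_of_eq ?_)
    simp [chr_norm]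
  | succ N ih =>
    intro f hf hp
    obtain ⟨C, hC⟩ := ih (fun v => fderiv ℝ f v (ev i))
      ((hf.fderiv_right (m := ((⊤ : ℕ∞) : WithTop ℕ∞)) (by simp)).clm_apply contDiff_const)
      (per_deriv hp _)
    refine ⟨C, fun m => le_trans ?_ (hC m)⟩
    rw [FC_deriv hf hp, pow_succ, mul_assoc]
    gcongr
    rw [norm_mul]
    gcongr
    simp only [norm_mul, Complex.norm_I, Complex.norm_real, Complex.norm_ofNat,
      Complex.norm_intCast, mul_one, Real.norm_eq_abs, abs_of_pos Real.pi_pos]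
    nlinarith [abs_nonneg (m i : ℝ), Real.pi_gt_three]

lemma decay (N : ℕ) {f : ℝ × ℝ → ℂ} (hf : ContDiff ℝ (⊤ : ℕ∞) f) (hp : Per f) :
    ∃ C : ℝ, 0 ≤ C ∧ ∀ m : Fin 2 → ℤ, ‖m‖ ^ N * ‖FC f m‖ ≤ C := by
  obtain ⟨C0, h0⟩ := decay1 0 N f hf hp
  obtain ⟨C1, h1⟩ := decay1 1 N f hf hp
  refine ⟨max 0 (max C0 C1), le_max_left _ _, fun m => ?_⟩
  have : ‖m‖ = max |(m 0 : ℝ)| |(m 1 : ℝ)| := by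
    simp [Pi.norm_def, Fin.univ_succ, Int.norm_eq_abs]
  rw [this]
  rcases le_total |(m 0 : ℝ)| |(m 1 : ℝ)| with h | h
  · rw [max_eq_right h]; exact (h1 m).trans (by simp)
  · rw [max_eq_left h]; exact (h0 m).trans (by simp)

lemma int_sq (F : ℝ × ℝ → ℂ) :
    ∫ x in {x : Fin 2 → ℝ | ∀ i, x i ∈ Set.Ioc ((0 : Fin 2 → ℝ) i) ((0 : Fin 2 → ℝ) i + 1)},
      F (x 0, x 1) = ∫ v in sq, F v := by
  have := (volume_preserving_finTwoArrow ℝ).setIntegral_preimage_emb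
    (MeasurableEquiv.finTwoArrow.measurableEmbedding) F sq
  rw [← this]
  congr 2
  ext x
  simp [sq, Fin.forall_fin_two]

lemma mFourier_chr (m : Fin 2 → ℤ) (x : Fin 2 → ℝ) :
    UnitAddTorus.mFourier m (fun i => (x i : UnitAddCircle)) = chr m (x 0, x 1) := by
  simp only [UnitAddTorus.mFourier, ContinuousMap.coe_mk, Fin.prod_univ_two, chr]
  erw [fourier_coe_apply, fourier_coe_apply]
  rw [← Complex.exp_add]
  congr 1
  push_cast; ring

lemma exists_lift {g : ℝ × ℝ → ℂ} (hg : Continuous g) (hp : Per g) :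
    ∃ G : C(UnitAddTorus (Fin 2), ℂ), ∀ x : Fin 2 → ℝ,
      G (fun i => (x i : UnitAddCircle)) = g (x 0, x 1) := by
  let G : UnitAddTorus (Fin 2) → ℂ := fun t =>
    g ((AddCircle.equivIco 1 0 (t 0) : ℝ), (AddCircle.equivIco 1 0 (t 1) : ℝ))
  have hG : ∀ x : Fin 2 → ℝ, G (fun i => (x i : UnitAddCircle)) = g (x 0, x 1) := by
    intro x
    have key : ∀ y : ℝ, ∃ k : ℤ, ((AddCircle.equivIco 1 0 (y : UnitAddCircle) : ℝ)) = y + k := by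
      intro y
      refine ⟨-⌊y⌋, ?_⟩
      have := AddCircle.coe_equivIco_mk_apply (1:ℝ) y
      rw [this]
      rw [div_one, mul_one, Int.fract]; push_cast; ring
    obtain ⟨k0, h0⟩ := key (x 0)
    obtain ⟨k1, h1⟩ := key (x 1)
    show g (_, _) = _
    rw [h0, h1]
    exact hp (k0, k1) (x 0, x 1)
  have hq : IsOpenQuotientMap (Pi.map (fun (_ : Fin 2) (y : ℝ) => (y : UnitAddCircle))) :=
    IsOpenQuotientMap.piMap fun _ => QuotientAddGroup.isOpenQuotientMap_mk
  have hcG : Continuous G := by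
    rw [hq.isQuotientMap.continuous_iff]
    have : G ∘ (Pi.map (fun (_ : Fin 2) (y : ℝ) => (y : UnitAddCircle))) =
        fun x => g (x 0, x 1) := funext hG
    rw [this]
    fun_prop
  exact ⟨⟨G, hcG⟩, hG⟩

lemma summable_norm3 : Summable fun m : Fin 2 → ℤ => (‖m‖ ^ 3)⁻¹ := by
  have := EisensteinSeries.summable_one_div_norm_rpow (k := 3) (by norm_num)
  refine this.congr fun m => ?_
  rw [Real.rpow_neg (norm_nonneg _)]
  norm_cast

lemma norm_pos' {m : Fin 2 → ℤ} (hm : m ≠ 0) : 0 < ‖m‖ := norm_pos_iff.mpr hm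

lemma FC_summable {g : ℝ × ℝ → ℂ} (hg : ContDiff ℝ (⊤ : ℕ∞) g) (hp : Per g) :
    Summable fun m => ‖FC g m‖ := by
  obtain ⟨C, hC0, hC⟩ := decay 3 hg hp
  have h1 : Summable fun m : Fin 2 → ℤ => C * (‖m‖ ^ 3)⁻¹ + (if m = 0 then ‖FC g 0‖ else 0) :=
    (summable_norm3.mul_left C).add (summable_of_hasFiniteSupport
      ((Set.finite_singleton (0 : Fin 2 → ℤ)).subset (fun m hm => by
        by_contra h; simp at h; simp [h] at hm)))
  refine Summable.of_nonneg_of_le (fun _ => norm_nonneg _) (fun m => ?_) h1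
  by_cases hm : m = 0
  · subst hm; simp
  · have := norm_pos' hm
    simp only [hm, if_false, add_zero]
    rw [← div_eq_mul_inv, le_div_iff₀ (by positivity), mul_comm]
    exact hC m

lemma fourier_series {g : ℝ × ℝ → ℂ} (hg : ContDiff ℝ (⊤ : ℕ∞) g) (hp : Per g) (v : ℝ × ℝ) :
    HasSum (fun m => FC g m * chr m v) (g v) := by
  obtain ⟨G, hG⟩ := exists_lift hg.continuous hp
  have hco : ∀ m, UnitAddTorus.mFourierCoeff G m = FC g m := by
    intro m
    rw [UnitAddTorus.mFourierCoeff_eq_integral G m 0, FC, ← int_sq]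
    simp only [mFourier_chr, hG, smul_eq_mul]
  have hs : Summable (UnitAddTorus.mFourierCoeff G) := by
    have : UnitAddTorus.mFourierCoeff G = FC g := funext hco
    rw [this]; exact (FC_summable hg hp).of_norm
  have := UnitAddTorus.hasSum_mFourier_series_apply_of_summable hs
    (fun i => ((![v.1, v.2] i : ℝ) : UnitAddCircle))
  simp only [hco, mFourier_chr, hG, smul_eq_mul] at this
  simpa using this

end AnosovMix
namespace AnosovMix

/-- Lucas-type sequence with `Bⁿ = pₙ B + qₙ`. -/
def pq (t d : ℤ) : ℕ → ℤ × ℤ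
  | 0 => (0, 1)
  | n + 1 => (t * (pq t d n).1 + (pq t d n).2, - d * (pq t d n).1)

lemma pq_growth (t d : ℤ) (hd : d = 1 ∨ d = -1) (ht : 2 < |t|) (n : ℕ) :
    2 ^ n ≤ |(pq t d (n+1)).1| ∧ |(pq t d (n+1)).2| ≤ |(pq t d (n+1)).1| := by
  induction n with
  | zero => simp [pq]
  | succ n ih =>
    obtain ⟨h1, h2⟩ := ih
    set p := (pq t d (n+1)).1 with hp
    set q := (pq t d (n+1)).2 with hq
    have e1 : (pq t d (n+1+1)).1 = t * p + q := rfl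
    have e2 : (pq t d (n+1+1)).2 = -d * p := rfl
    have h3 : |t| * |p| - |q| ≤ |t * p + q| := by
      rw [← abs_mul]
      have := abs_sub_abs_le_abs_sub (t * p) (-q)
      rw [abs_neg, sub_neg_eq_add] at this
      exact this
    have hdd : |-d| = 1 := by rcases hd with h | h <;> simp [h]
    have h4 : 2 * |p| ≤ |t * p + q| := by nlinarith [abs_nonneg p]
    rw [e1, e2, abs_mul, hdd]
    constructor
    · rw [pow_succ]; linarith
    · linarith [abs_nonneg p]

lemma pow_eq (B : Matrix (Fin 2) (Fin 2) ℤ) (n : ℕ) :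
    B ^ n = (pq B.trace B.det n).1 • B + (pq B.trace B.det n).2 • (1 : Matrix (Fin 2) (Fin 2) ℤ) := by
  induction n with
  | zero => simp [pq]
  | succ n ih =>
    rw [pow_succ, ih]
    simp only [pq]
    generalize (pq B.trace B.det n).1 = p
    generalize (pq B.trace B.det n).2 = q
    ext i j
    simp only [Matrix.mul_apply, Matrix.trace_fin_two, Matrix.det_fin_two, Matrix.add_apply,
      Matrix.smul_apply, smul_eq_mul, Fin.sum_univ_two, Matrix.one_apply]
    fin_cases i <;> fin_cases j <;> simp <;> ring

lemma not_sq (t d s : ℤ) (hd : d = 1 ∨ d = -1) (ht : 2 < |t|) : t ^ 2 - 4 * d ≠ s ^ 2 := by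
  intro h
  rw [← sq_abs t, ← sq_abs s] at h
  have hs := abs_nonneg s
  generalize |t| = t at *
  generalize |s| = s at *
  rcases hd with rfl | rfl
  · have h1 : s < t := by nlinarith
    have h2 : t - 1 < s := by nlinarith
    omega
  · have h1 : t < s := by nlinarith
    have h2 : s < t + 1 := by nlinarith
    omega

lemma form_ne (B : Matrix (Fin 2) (Fin 2) ℤ) (hd : B.det = 1 ∨ B.det = -1) (ht : 2 < |B.trace|)
    (m : Fin 2 → ℤ) (hm : m ≠ 0) :
    m 0 * (B.mulVec m) 1 - m 1 * (B.mulVec m) 0 ≠ 0 := by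
  intro h
  have hns := fun s => not_sq B.trace B.det s hd ht
  simp only [Matrix.mulVec, dotProduct, Fin.sum_univ_two, Matrix.trace_fin_two,
    Matrix.det_fin_two] at h hns
  generalize B 0 0 = a at *
  generalize B 0 1 = c at *
  generalize B 1 0 = b at *
  generalize B 1 1 = d at *
  have hxy : m 0 ≠ 0 ∨ m 1 ≠ 0 := by
    by_contra! hh
    exact hm (by ext i; fin_cases i <;> simp [hh.1, hh.2])
  generalize m 0 = x at *
  generalize m 1 = y at *
  by_cases hy : y = 0
  · subst hy
    have hx : x ≠ 0 := by simpa using hxy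
    have hb : b = 0 := by
      have : b * (x * x) = 0 := by linarith
      simpa [hx] using this
    exact hns (a - d) (by rw [hb]; ring)
  · have h1 : (2 * b * x + (d - a) * y) ^ 2 = ((a + d) ^ 2 - 4 * (a * d - c * b)) * y ^ 2 := by
      linear_combination 4 * b * h
    have h2 : y ^ 2 ∣ (2 * b * x + (d - a) * y) ^ 2 := ⟨(a + d) ^ 2 - 4 * (a * d - c * b), by rw [h1]; ring⟩
    rw [Int.pow_dvd_pow_iff (by norm_num)] at h2
    obtain ⟨k, hk⟩ := h2
    rw [hk] at h1
    apply hns k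
    have : y ^ 2 ≠ 0 := pow_ne_zero 2 hy
    apply mul_right_cancel₀ this
    linarith

lemma norm_lower (B : Matrix (Fin 2) (Fin 2) ℤ) (hd : B.det = 1 ∨ B.det = -1)
    (ht : 2 < |B.trace|) (m : Fin 2 → ℤ) (hm : m ≠ 0) (n : ℕ) :
    (2:ℝ) ^ n ≤ 2 * (‖m‖ * ‖(B ^ (n+1)).mulVec m‖) := by
  have h1 := form_ne B hd ht m hm
  have h2 := (pq_growth B.trace B.det hd ht n).1
  set w := (B ^ (n+1)).mulVec m with hw
  have h3 : m 0 * w 1 - m 1 * w 0 = (pq B.trace B.det (n+1)).1 *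
      (m 0 * (B.mulVec m) 1 - m 1 * (B.mulVec m) 0) := by
    rw [hw, pow_eq, Matrix.add_mulVec, Matrix.smul_mulVec, Matrix.smul_mulVec, Matrix.one_mulVec]
    simp only [Pi.add_apply, Pi.smul_apply, smul_eq_mul]; ring
  have h4 : (2:ℤ) ^ n ≤ |m 0 * w 1 - m 1 * w 0| := by
    rw [h3, abs_mul]
    have := Int.one_le_abs h1
    nlinarith [abs_nonneg (pq B.trace B.det (n+1)).1]
  have h5 : (2:ℝ) ^ n ≤ |(m 0 : ℝ) * w 1 - m 1 * w 0| := by exact_mod_cast h4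
  have nm : ∀ (u : Fin 2 → ℤ) i, |(u i : ℝ)| ≤ ‖u‖ := fun u i => by
    have := norm_le_pi_norm u i
    rwa [Int.norm_eq_abs] at this
  calc (2:ℝ) ^ n ≤ |(m 0 : ℝ) * w 1 - m 1 * w 0| := h5
    _ ≤ |(m 0 : ℝ) * w 1| + |(m 1 : ℝ) * w 0| := abs_sub _ _
    _ ≤ ‖m‖ * ‖w‖ + ‖m‖ * ‖w‖ := by
        rw [abs_mul, abs_mul]
        gcongr <;> apply nm
    _ = _ := by ring

end AnosovMix

namespace AnosovMix

lemma chr_TA (A : Matrix (Fin 2) (Fin 2) ℤ) (TA : ℝ × ℝ → ℝ × ℝ)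
    (hTA : ∀ v, TA v = ((A 0 0 : ℝ) * v.1 + (A 0 1 : ℝ) * v.2,
      (A 1 0 : ℝ) * v.1 + (A 1 1 : ℝ) * v.2)) (n : ℕ) (m : Fin 2 → ℤ) :
    ∀ v, chr m (TA^[n] v) = chr ((A.transpose ^ n).mulVec m) v := by
  induction n with
  | zero => intro v; simp
  | succ n ih =>
    intro v
    rw [Function.iterate_succ_apply, ih, pow_succ', ← Matrix.mulVec_mulVec]
    generalize (A.transpose ^ n).mulVec m = w
    rw [hTA]
    simp only [chr, Matrix.mulVec, dotProduct, Fin.sum_univ_two, Matrix.transpose_apply]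
    congr 1
    push_cast; ring

lemma corr_hasSum {f g : ℝ × ℝ → ℂ} (hf : ContDiff ℝ (⊤ : ℕ∞) f) (hg : ContDiff ℝ (⊤ : ℕ∞) g)
    (hgp : Per g) (T : ℝ × ℝ → ℝ × ℝ) (S : (Fin 2 → ℤ) → (Fin 2 → ℤ))
    (hT : ∀ m v, chr m (T v) = chr (S m) v) :
    HasSum (fun m => FC g m * FC f (-(S m))) (∫ v in sq, f v * g (T v)) := by
  have hcont : ∀ m, Continuous (fun v => FC g m * (chr (S m) v * f v)) := fun m =>
    continuous_const.mul ((chr_contDiff _).continuous.mul hf.continuous)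
  have h := hasSum_integral_of_summable_integral_norm (μ := volume.restrict sq)
    (F := fun m v => FC g m * (chr (S m) v * f v)) (fun m => intOn (hcont m)) (by
      simp only [norm_mul, chr_norm, one_mul, integral_const_mul]
      exact (FC_summable hg hgp).mul_right _)
  have e1 : ∀ v, ∑' m, FC g m * (chr (S m) v * f v) = f v * g (T v) := by
    intro v
    rw [← (fourier_series hg hgp (T v)).tsum_eq, ← tsum_mul_left]
    refine tsum_congr fun m => ?_
    rw [hT]; ring
  simp only [e1, integral_const_mul] at h
  simpa only [FC, neg_neg] using h

end AnosovMix

open AnosovMix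
theorem linear_anosov_superexponential_mixing (A : Matrix (Fin 2) (Fin 2) ℤ)
    (hdet : A.det = 1 ∨ A.det = -1) (htr : 2 < |A.trace|)
    (f g : ℝ × ℝ → ℂ) (hf : ContDiff ℝ (⊤ : ℕ∞) f) (hg : ContDiff ℝ (⊤ : ℕ∞) g)
    (hfp : ∀ (m : ℤ × ℤ) (v : ℝ × ℝ), f (v.1 + m.1, v.2 + m.2) = f v)
    (hgp : ∀ (m : ℤ × ℤ) (v : ℝ × ℝ), g (v.1 + m.1, v.2 + m.2) = g v)
    (TA : ℝ × ℝ → ℝ × ℝ)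
    (hTA : ∀ v, TA v = ((A 0 0 : ℝ) * v.1 + (A 0 1 : ℝ) * v.2,
      (A 1 0 : ℝ) * v.1 + (A 1 1 : ℝ) * v.2))
    (ε : ℝ) (hε : 0 < ε) :
    (fun n : ℕ => (∫ v in Set.Ioc (0:ℝ) 1 ×ˢ Set.Ioc (0:ℝ) 1, f v * g (TA^[n] v)) -
        (∫ v in Set.Ioc (0:ℝ) 1 ×ˢ Set.Ioc (0:ℝ) 1, f v) *
          ∫ v in Set.Ioc (0:ℝ) 1 ×ˢ Set.Ioc (0:ℝ) 1, g v)
      =o[Filter.atTop] (fun n : ℕ => ε ^ n) := by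
  obtain ⟨N, hN⟩ := exists_pow_lt_of_lt_one hε (by norm_num : (1/2 : ℝ) < 1)
  set B := A.transpose with hB
  have hBd : B.det = 1 ∨ B.det = -1 := by rwa [hB, Matrix.det_transpose]
  have hBt : 2 < |B.trace| := by rwa [hB, Matrix.trace_transpose]
  obtain ⟨Cf, hCf0, hCf⟩ := decay N hf hfp
  obtain ⟨Cg, hCg0, hCg⟩ := decay (N + 3) hg hgp
  set K : ℝ := ∑' m : Fin 2 → ℤ, (‖m‖ ^ 3)⁻¹ with hK
  have main : ∀ n : ℕ, ‖(∫ v in sq, f v * g (TA^[n+1] v)) - (∫ v in sq, f v) * ∫ v in sq, g v‖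
      ≤ (Cg * Cf * 4 ^ N * K) * ((1/2 : ℝ) ^ N) ^ (n+1) := by
    intro n
    have hs := corr_hasSum hf hg hgp (TA^[n+1]) (fun m => (B ^ (n+1)).mulVec m)
      (chr_TA A TA hTA (n+1))
    have hs2 := hasSum_ite_sub_hasSum hs 0
    have e0 : FC g 0 * FC f (-((B ^ (n+1)).mulVec 0)) = (∫ v in sq, f v) * ∫ v in sq, g v := by
      simp [FC, chr_zero, mul_comm]
    rw [e0] at hs2
    have hb : HasSum (fun m : Fin 2 → ℤ =>
        (Cg * Cf * 4 ^ N * ((1/2 : ℝ) ^ N) ^ (n+1)) * (‖m‖ ^ 3)⁻¹)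
        ((Cg * Cf * 4 ^ N * ((1/2 : ℝ) ^ N) ^ (n+1)) * K) :=
      summable_norm3.hasSum.mul_left _
    have hle := hs2.norm_le_of_bounded hb (fun m => by
      by_cases hm : m = 0
      · simp [hm]
      · simp only [hm, if_false]
        have hmp := norm_pos' hm
        have hlow := norm_lower B hBd hBt m hm n
        set w := (B ^ (n+1)).mulVec m
        have h1 := hCg m
        have h2 := hCf (-w)
        rw [norm_neg] at h2
        rw [norm_mul, ← div_eq_mul_inv, le_div_iff₀ (by positivity)]
        have h3 : ((2:ℝ) ^ (n+1)) ^ N ≤ 4 ^ N * (‖m‖ ^ N * ‖w‖ ^ N) := by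
          rw [← mul_pow, ← mul_pow]
          gcongr
          rw [pow_succ]; linarith
        have h4 : ((1/2 : ℝ) ^ N) ^ (n+1) = (((2:ℝ) ^ (n+1)) ^ N)⁻¹ := by
          rw [← pow_mul, ← pow_mul, mul_comm, one_div, inv_pow]
        rw [h4, ← div_eq_mul_inv, le_div_iff₀ (by positivity)]
        calc ‖FC g m‖ * ‖FC f (-w)‖ * ‖m‖ ^ 3 * (2 ^ (n+1)) ^ N
            ≤ ‖FC g m‖ * ‖FC f (-w)‖ * ‖m‖ ^ 3 * (4 ^ N * (‖m‖ ^ N * ‖w‖ ^ N)) := by gcongr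
          _ = (‖m‖ ^ (N + 3) * ‖FC g m‖) * (‖w‖ ^ N * ‖FC f (-w)‖) * 4 ^ N := by ring
          _ ≤ Cg * Cf * 4 ^ N := by gcongr)
    refine hle.trans (le_of_eq ?_)
    ring
  refine Asymptotics.IsBigO.trans_isLittleO (g := fun n : ℕ => ((1/2 : ℝ) ^ N) ^ n) ?_
    (isLittleO_pow_pow_of_lt_left (by positivity) hN)
  refine Asymptotics.IsBigO.of_bound (Cg * Cf * 4 ^ N * K) ?_
  filter_upwards [Filter.eventually_ge_atTop 1] with n hn
  obtain ⟨k, rfl⟩ := Nat.exists_eq_add_of_le' hn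
  refine (main k).trans (le_of_eq ?_)
  rw [Real.norm_of_nonneg (by positivity)]
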